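/- Let 1 ≤ p < ∞ and let Z = {Z(L)} be a triangular family of finite point sets in S^d such that each Z(L) is a union of at most N subsets, each pairwise separated by geodesic distance at least ε/(L+1). Then there is a constant C (depending on p, d, N, ε) such that for all L ≥ 1 and all Q ∈ Π_L: (1/π_L) Σ_{z ∈ Z(L)} |Q(z)|^p ≤ C ∫_{S^d} |Q|^p dσ. -/

import Mathlib

open MeasureTheory MvPolynomial
open scoped RealInnerProductSpace ENNReal

noncomputable section

abbrev Esp (d : ℕ) : Type := EuclideanSpace ℝ (Fin (d+1))

abbrev Sph (d : ℕ) := Metric.sphere (0 : Esp d) 1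

/-- The surface measure on the unit sphere `S^d`. -/
def sphMeasure (d : ℕ) : Measure (Sph d) := (volume : Measure (Esp d)).toSphere

/-- The Laplacian on polynomials in `d+1` variables. -/
def polyLap (d : ℕ) : MvPolynomial (Fin (d+1)) ℝ →ₗ[ℝ] MvPolynomial (Fin (d+1)) ℝ :=
  ∑ i : Fin (d+1), ((pderiv i).toLinearMap ∘ₗ (pderiv i).toLinearMap)

/-- Homogeneous harmonic polynomials of degree `ℓ` in `d+1` variables. -/
def harmHomog (d ℓ : ℕ) : Submodule ℝ (MvPolynomial (Fin (d+1)) ℝ) :=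
  homogeneousSubmodule (Fin (d+1)) ℝ ℓ ⊓ LinearMap.ker (polyLap d)

/-- Restriction of polynomials to the unit sphere, as a linear map. -/
def restrictSph (d : ℕ) : MvPolynomial (Fin (d+1)) ℝ →ₗ[ℝ] (Sph d → ℝ) where
  toFun P := fun x => eval (fun i => (x : Esp d) i) P
  map_add' P Q := by funext x; simp
  map_smul' r P := by funext x; simp [smul_eval]

/-- Spherical harmonics of degree `ℓ` on `S^d`. -/
def Hsp (d ℓ : ℕ) : Submodule ℝ (Sph d → ℝ) := (harmHomog d ℓ).map (restrictSph d)

/-- Spherical harmonics of degree at most `L` on `S^d`. -/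
def PiSp (d L : ℕ) : Submodule ℝ (Sph d → ℝ) := ⨆ ℓ : Fin (L+1), Hsp d ℓ

/-- Sums of homogeneous harmonic polynomials of degrees `≤ L` :
polynomial (harmonic-extension) model of `Π_L`. -/
def harmPolyLe (d L : ℕ) : Submodule ℝ (MvPolynomial (Fin (d+1)) ℝ) :=
  ⨆ ℓ : Fin (L+1), harmHomog d ℓ

/-- The north pole of `S^d`. -/
def north (d : ℕ) : Sph d :=
  ⟨EuclideanSpace.single 0 1, by
    simp [mem_sphere_zero_iff_norm, EuclideanSpace.norm_single]⟩

/-- The geodesic distance on `S^d`. -/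
def gdist (d : ℕ) (x y : Sph d) : ℝ := Real.arccos ⟪(x : Esp d), (y : Esp d)⟫


/-- directional derivative -/
def dirD {n : ℕ} (v : Fin n → ℝ) : MvPolynomial (Fin n) ℝ →ₗ[ℝ] MvPolynomial (Fin n) ℝ :=
  ∑ i, v i • (pderiv i).toLinearMap

lemma dirD_apply {n : ℕ} (v : Fin n → ℝ) (P : MvPolynomial (Fin n) ℝ) :
    dirD v P = ∑ i, v i • pderiv i P := by
  simp [dirD]

/-- restriction to a line -/
def lineP {n : ℕ} (y v : Fin n → ℝ) (P : MvPolynomial (Fin n) ℝ) : Polynomial ℝ :=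
  aeval (fun i => Polynomial.C (y i) + Polynomial.X * Polynomial.C (v i)) P

lemma lineP_eval {n : ℕ} (y v : Fin n → ℝ) (P : MvPolynomial (Fin n) ℝ) (t : ℝ) :
    (lineP y v P).eval t = eval (fun i => y i + t * v i) P := by
  unfold lineP
  induction P using MvPolynomial.induction_on with
  | C a => simp
  | add p q hp hq => rw [map_add, Polynomial.eval_add, hp, hq, map_add]
  | mul_X p i hp => rw [map_mul, Polynomial.eval_mul, hp, map_mul, aeval_X, eval_X]; simp; ring_nf; simp

lemma lineP_derivative {n : ℕ} (y v : Fin n → ℝ) (P : MvPolynomial (Fin n) ℝ) :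
    Polynomial.derivative (lineP y v P) = lineP y v (dirD v P) := by
  induction P using MvPolynomial.induction_on with
  | C a => simp [lineP, dirD_apply]
  | add p q hp hq =>
    have : ∀ p q, lineP y v (p + q) = lineP y v p + lineP y v q := fun p q => by simp [lineP]
    rw [map_add, this, this, map_add, hp, hq]
  | mul_X p i hp =>
    have h2 : dirD v (p * X i) = dirD v p * X i + C (v i) * p := by
      simp only [dirD_apply, Derivation.leibniz, pderiv_X, smul_add, Finset.sum_add_distrib,
        Finset.sum_mul]
      rw [add_comm]
      congr 1
      · apply Finset.sum_congr rfl; intro j _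
        simp only [smul_eq_mul, smul_eq_C_mul]; ring
      · rw [Finset.sum_eq_single i]
        · simp [smul_eq_C_mul]
        · intro j _ hj
          simp [Pi.single_apply, hj.symm]
        · simp
    have h1 : lineP y v (p * X i) = lineP y v p * (Polynomial.C (y i) + Polynomial.X * Polynomial.C (v i)) := by
      simp [lineP]
    rw [h1, h2, Polynomial.derivative_mul, hp]
    simp [lineP]; ring

lemma lineP_iterate {n : ℕ} (y v : Fin n → ℝ) (P : MvPolynomial (Fin n) ℝ) (k : ℕ) :
    Polynomial.derivative^[k] (lineP y v P) = lineP y v ((dirD v)^[k] P) := by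
  induction k generalizing P with
  | zero => rfl
  | succ k ih => rw [Function.iterate_succ_apply, Function.iterate_succ_apply, lineP_derivative, ih]

lemma lineP_natDegree {n : ℕ} (y v : Fin n → ℝ) (P : MvPolynomial (Fin n) ℝ) :
    (lineP y v P).natDegree ≤ P.totalDegree := by
  unfold lineP
  rw [aeval_def, eval₂_eq']
  apply Polynomial.natDegree_sum_le_of_forall_le
  intro m hm
  refine (Polynomial.natDegree_C_mul_le _ _).trans ?_
  refine (Polynomial.natDegree_prod_le _ _).trans ?_
  refine le_trans ?_ (le_totalDegree hm)
  rw [Finsupp.sum_fintype _ _ (by simp)]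
  apply Finset.sum_le_sum
  intro i _
  refine Polynomial.natDegree_pow_le.trans ?_
  have : (Polynomial.C (y i) + Polynomial.X * Polynomial.C (v i)).natDegree ≤ 1 := by
    compute_degree
  nlinarith

lemma taylor_eval {n : ℕ} (y z : Fin n → ℝ) (P : MvPolynomial (Fin n) ℝ) (L : ℕ)
    (hL : P.totalDegree ≤ L) :
    eval z P = ∑ k ∈ Finset.range (L+1), (k.factorial : ℝ)⁻¹ *
      eval y ((dirD (fun i => z i - y i))^[k] P) := by
  set v := fun i => z i - y i
  have h1 : eval z P = (lineP y v P).eval 1 := by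
    rw [lineP_eval]; simp [v]
  rw [h1, Polynomial.eval_eq_sum_range' (Nat.lt_succ_of_le ((lineP_natDegree y v P).trans hL))]
  apply Finset.sum_congr rfl
  intro k _
  have h2 : eval y ((dirD v)^[k] P) = (Polynomial.derivative^[k] (lineP y v P)).eval 0 := by
    rw [lineP_iterate, lineP_eval]; simp
  rw [h2, ← Polynomial.coeff_zero_eq_eval_zero, Polynomial.coeff_iterate_derivative]
  have : (k.factorial : ℝ) ≠ 0 := by positivity
  simp [Nat.descFactorial_self]
  field_simp

/-- sum of absolute values of all `k`-th order derivatives -/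
def Gk {n : ℕ} : ℕ → MvPolynomial (Fin n) ℝ → (Fin n → ℝ) → ℝ
  | 0, P, y => |eval y P|
  | k+1, P, y => ∑ i, Gk k (pderiv i P) y

lemma Gk_nonneg {n : ℕ} (k : ℕ) (P : MvPolynomial (Fin n) ℝ) (y) : 0 ≤ Gk k P y := by
  induction k generalizing P with
  | zero => exact abs_nonneg _
  | succ k ih => exact Finset.sum_nonneg fun i _ => ih _

lemma Gk_cont {n : ℕ} (k : ℕ) (P : MvPolynomial (Fin n) ℝ) : Continuous (Gk k P) := by
  induction k generalizing P with
  | zero => exact (MvPolynomial.continuous_eval P).abs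
  | succ k ih => exact continuous_finsetSum _ fun i _ => ih _

lemma dirD_iter_sum {n : ℕ} {ι : Type*} (v : Fin n → ℝ) (s : Finset ι) (c : ι → ℝ)
    (f : ι → MvPolynomial (Fin n) ℝ) (k : ℕ) :
    (dirD v)^[k] (∑ i ∈ s, c i • f i) = ∑ i ∈ s, c i • (dirD v)^[k] (f i) := by
  rw [← Module.End.coe_pow]; simp

lemma abs_dirD_le {n : ℕ} (v : Fin n → ℝ) (δ : ℝ) (hv : ∀ i, |v i| ≤ δ) (hδ : 0 ≤ δ) (k : ℕ)
    (P : MvPolynomial (Fin n) ℝ) (y) :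
    |eval y ((dirD v)^[k] P)| ≤ δ ^ k * Gk k P y := by
  induction k generalizing P with
  | zero => simp [Gk]
  | succ k ih =>
    rw [Function.iterate_succ_apply, dirD_apply, dirD_iter_sum, map_sum, Gk, Finset.mul_sum]
    refine (Finset.abs_sum_le_sum_abs _ _).trans (Finset.sum_le_sum fun i _ => ?_)
    rw [smul_eval, abs_mul, pow_succ']
    have := ih (pderiv i P)
    calc _ ≤ δ * (δ^k * Gk k (pderiv i P) y) := by
          gcongr; exact hv i
      _ = _ := by ring

/-- majorant -/
def Phi {n : ℕ} (L : ℕ) (δ : ℝ) (P : MvPolynomial (Fin n) ℝ) (y : Fin n → ℝ) : ℝ :=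
  ∑ k ∈ Finset.range (L+1), ((k.factorial : ℝ)⁻¹ * δ^k) * Gk k P y

lemma le_Phi {n : ℕ} (L : ℕ) (δ : ℝ) (hδ : 0 ≤ δ) (P : MvPolynomial (Fin n) ℝ)
    (hL : P.totalDegree ≤ L) (y z : Fin n → ℝ) (h : ∀ i, |z i - y i| ≤ δ) :
    |eval z P| ≤ Phi L δ P y := by
  rw [taylor_eval y z P L hL, Phi]
  refine (Finset.abs_sum_le_sum_abs _ _).trans (Finset.sum_le_sum fun k _ => ?_)
  rw [abs_mul, abs_of_nonneg (by positivity), mul_assoc]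
  gcongr
  exact abs_dirD_le _ δ h hδ k P y

lemma Phi_nonneg {n : ℕ} (L : ℕ) (δ : ℝ) (hδ : 0 ≤ δ) (P : MvPolynomial (Fin n) ℝ) (y) :
    0 ≤ Phi L δ P y := Finset.sum_nonneg fun k _ => mul_nonneg (by positivity) (Gk_nonneg _ _ _)

lemma Phi_cont {n : ℕ} (L : ℕ) (δ : ℝ) (P : MvPolynomial (Fin n) ℝ) : Continuous (Phi L δ P) :=
  continuous_finsetSum _ fun k _ => continuous_const.mul (Gk_cont k P)

/-! max principle -/

lemma poly_not_localMax (q : Polynomial ℝ) (h2 : 0 < q.derivative.derivative.eval 0)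
    (hm : IsLocalMax (fun t => q.eval t) 0) : False := by
  have hd : deriv (fun t => q.eval t) = fun t => q.derivative.eval t := by
    funext t; simp
  have hd2 : deriv (deriv (fun t => q.eval t)) = fun t => q.derivative.derivative.eval t := by
    rw [hd]; funext t; simp
  have hmin := isLocalMin_of_deriv_deriv_pos (f := fun t => q.eval t) (x₀ := 0)
    (by rw [hd2]; exact h2) hm.deriv_eq_zero q.continuous.continuousAt
  have hev : (fun t => q.eval t) =ᶠ[nhds 0] fun _ => q.eval 0 := by
    filter_upwards [hm, hmin] with t h1 h2
    exact le_antisymm h1 h2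
  have := hev.deriv.deriv.eq_of_nhds
  rw [hd2] at this
  simp at this
  linarith

lemma eval_polyLap (d : ℕ) (P : MvPolynomial (Fin (d+1)) ℝ) :
    polyLap d P = ∑ i, pderiv i (pderiv i P) := by
  simp [polyLap]

lemma dirD_single {n : ℕ} (i : Fin n) (P : MvPolynomial (Fin n) ℝ) :
    dirD (Pi.single i 1) P = pderiv i P := by
  rw [dirD_apply, Finset.sum_eq_single i]
  · simp
  · intro j _ hj; simp [hj]
  · simp

lemma max_principle (d : ℕ) (P : MvPolynomial (Fin (d+1)) ℝ) (hP : polyLap d P = 0)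
    (h0 : ∀ x : Esp d, ‖x‖ = 1 → eval (fun i => x i) P = 0) (x : Esp d) (hx : ‖x‖ ≤ 1) :
    eval (fun i => x i) P ≤ 0 := by
  apply le_of_forall_pos_le_add
  intro e he
  rw [zero_add]
  set V : MvPolynomial (Fin (d+1)) ℝ := P + C e * ∑ i, X i ^ 2 with hV
  have hVe : ∀ x : Esp d, eval (fun i => x i) V = eval (fun i => x i) P + e * ‖x‖^2 := by
    intro x
    simp [hV, EuclideanSpace.norm_sq_eq]
  have hlap : polyLap d V = C (2 * e * (d+1)) := by
    rw [hV, map_add, hP, zero_add, eval_polyLap]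
    have : ∀ i : Fin (d+1), pderiv i (pderiv i (C e * ∑ j, X j ^ 2 : MvPolynomial (Fin (d+1)) ℝ)) = C (2*e) := by
      intro i
      have h1 : pderiv i (∑ j, X j ^ 2 : MvPolynomial (Fin (d+1)) ℝ) = C 2 * X i := by
        rw [map_sum, Finset.sum_eq_single i]
        · rw [pderiv_pow]; simp; rfl
        · intro j _ hj; rw [pderiv_pow, pderiv_X_of_ne hj]; simp
        · simp
      rw [pderiv_C_mul, h1, pderiv_C_mul, pderiv_C_mul, pderiv_X_self]
      simp only [mul_one, ← C_mul]; rw [mul_comm]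
    simp only [this]
    simp
    ring
  obtain ⟨w, hw, hmax⟩ := (isCompact_closedBall (0 : Esp d) 1).exists_isMaxOn
    ⟨0, by simp⟩ (f := fun x : Esp d => eval (fun i => x i) V)
    (by
      apply Continuous.continuousOn
      exact (MvPolynomial.continuous_eval V).comp (by fun_prop))
  have hkey : eval (fun i => w i) V ≤ e := by
    rcases (mem_closedBall_zero_iff.1 hw).lt_or_eq with hlt | heq
    · exfalso
      have hsum : ∑ i, eval (fun i => w i) (pderiv i (pderiv i V)) = 2 * e * (d+1) := by
        rw [← map_sum, ← eval_polyLap, hlap, eval_C]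
      have hpos : 0 < 2 * e * ((d:ℝ)+1) := by positivity
      obtain ⟨i, hi⟩ : ∃ i, 0 < eval (fun i => w i) (pderiv i (pderiv i V)) := by
        by_contra! hcon
        have := Finset.sum_nonpos (s := Finset.univ) fun i _ => hcon i
        linarith
      apply poly_not_localMax (lineP (fun i => w i) (Pi.single i 1) V)
      · rw [lineP_derivative, lineP_derivative, dirD_single, dirD_single, lineP_eval]
        simpa using hi
      · have hc : Continuous fun t : ℝ => w + t • EuclideanSpace.single i (1:ℝ) := by fun_prop
        have hnh : ∀ᶠ t in nhds (0:ℝ), w + t • EuclideanSpace.single i (1:ℝ) ∈ Metric.ball (0 : Esp d) 1 :=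
          hc.continuousAt.eventually_mem (Metric.isOpen_ball.mem_nhds (by simpa using hlt))
        filter_upwards [hnh] with t ht
        have := hmax (Metric.ball_subset_closedBall ht)
        simp only [Set.mem_ofPred_eq] at this
        rw [lineP_eval, lineP_eval]
        convert this using 3
        · funext j; by_cases hj : j = i <;> simp [hj]
        · simp
    · rw [hVe, h0 w heq, heq]; simp
  have h1 := hmax (mem_closedBall_zero_iff.2 hx)
  simp only [Set.mem_ofPred_eq] at h1
  have h2 := hVe x
  have : 0 ≤ e * ‖x‖^2 := by positivity
  linarith

lemma polyHarm_eq_zero (d : ℕ) (P : MvPolynomial (Fin (d+1)) ℝ) (hP : polyLap d P = 0)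
    (h0 : ∀ x : Esp d, ‖x‖ = 1 → eval (fun i => x i) P = 0) : P = 0 := by
  have hz : ∀ x : Esp d, ‖x‖ ≤ 1 → eval (fun i => x i) P = 0 := by
    intro x hx
    apply le_antisymm (max_principle d P hP h0 x hx)
    have := max_principle d (-P) (by rw [map_neg, hP, neg_zero])
      (fun x hx => by simp [h0 x hx]) x hx
    simpa using this
  apply MvPolynomial.funext
  intro x
  rw [map_zero]
  set X : Esp d := WithLp.toLp 2 x
  have hpoly : lineP 0 x P = 0 := by
    apply Polynomial.eq_zero_of_infinite_isRoot
    have hX : 0 < 1 + ‖X‖ := by positivity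
    apply (Set.Icc_infinite (a := (0:ℝ)) (b := (1 + ‖X‖)⁻¹) (by positivity)).mono
    intro t ht
    show Polynomial.eval t _ = 0
    rw [lineP_eval]
    have := hz (t • X) (by
      rw [norm_smul, Real.norm_of_nonneg ht.1]
      calc t * ‖X‖ ≤ (1+‖X‖)⁻¹ * (1 + ‖X‖) := by
            apply mul_le_mul ht.2 (by linarith) (norm_nonneg _) (by positivity)
        _ = 1 := by field_simp)
    simpa [X] using this
  have := lineP_eval 0 x P 1
  rw [hpoly] at this
  simpa using this.symm

lemma zsum (M : ℕ) (ζ : ℂ) (hζ : IsPrimitiveRoot ζ M) (m : ℤ) :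
    ∑ j ∈ Finset.range M, (ζ ^ m) ^ j = if (M : ℤ) ∣ m then (M : ℂ) else 0 := by
  split_ifs with h
  · rw [(hζ.zpow_eq_one_iff_dvd m).2 h]; simp
  · have h1 : ζ ^ m ≠ 1 := fun h' => h ((hζ.zpow_eq_one_iff_dvd m).1 h')
    rw [geom_sum_eq h1]
    have : (ζ ^ m) ^ M = 1 := by
      rw [← zpow_natCast, ← zpow_mul, mul_comm, zpow_mul, zpow_natCast, hζ.pow_eq_one, one_zpow]
    rw [this]; simp

/-- Fejer kernel at discrete points -/
def fejF (L : ℕ) (ζ : ℂ) (j : ℕ) : ℝ := Complex.normSq (∑ a ∈ Finset.range L, (ζ ^ j) ^ a) / L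

lemma fejF_nonneg (L : ℕ) (ζ : ℂ) (j : ℕ) : 0 ≤ fejF L ζ j := by
  unfold fejF; have := Complex.normSq_nonneg (∑ a ∈ Finset.range L, (ζ ^ j) ^ a); positivity

lemma fejF_expand (L : ℕ) (ζ : ℂ) (hz : ‖ζ‖ = 1) (j : ℕ) (m : ℤ) :
    (fejF L ζ j : ℂ) * (ζ ^ (-m)) ^ j = (L:ℂ)⁻¹ * ∑ a ∈ Finset.range L, ∑ b ∈ Finset.range L,
      (ζ ^ ((a:ℤ) - b - m)) ^ j := by
  have h0 : ζ ≠ 0 := by intro h; simp [h] at hz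
  unfold fejF
  push_cast
  rw [← Complex.mul_conj, map_sum, Finset.sum_mul_sum, div_eq_inv_mul, mul_assoc, Finset.sum_mul]
  congr 1
  apply Finset.sum_congr rfl; intro a _
  rw [Finset.sum_mul]
  apply Finset.sum_congr rfl; intro b _
  have hc : (starRingEnd ℂ) ζ = ζ⁻¹ := by
    rw [Complex.inv_def, Complex.normSq_eq_norm_sq, hz]; simp
  rw [map_pow, map_pow, hc, zpow_sub₀ h0, zpow_sub₀ h0, zpow_neg]
  simp only [zpow_natCast, div_pow, inv_pow, ← pow_mul, ]
  rw [mul_comm j a, mul_comm j b]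
  field_simp

lemma count_sum (L m : ℕ) : ∑ a ∈ Finset.range L, ∑ b ∈ Finset.range L,
    (if a = b + m then (1:ℂ) else 0) = ((L - m : ℕ) : ℂ) := by
  rw [Finset.sum_comm]
  have : ∀ b ∈ Finset.range L, ∑ a ∈ Finset.range L, (if a = b + m then (1:ℂ) else 0)
      = if b < L - m then 1 else 0 := by
    intro b _
    rw [Finset.sum_ite_eq']
    simp only [Finset.mem_range]
    congr 1
    exact propext (by omega)
  rw [Finset.sum_congr rfl this, Finset.sum_ite, Finset.sum_const_zero, add_zero, Finset.sum_const]
  have : Finset.filter (fun b => b < L - m) (Finset.range L) = Finset.range (L - m) := by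
    ext b; simp; omega
  rw [this]; simp

lemma fej_sum (L : ℕ) (hL : 1 ≤ L) (ζ : ℂ) (hz : ‖ζ‖ = 1) (hζ : IsPrimitiveRoot ζ (3*L)) (m : ℕ)
    (hm : m ≤ 2 * L) :
    ∑ j ∈ Finset.range (3*L), (fejF L ζ j : ℂ) * (ζ ^ (-(m:ℤ))) ^ j = 3 * ((L - m : ℕ) : ℂ) := by
  simp_rw [fejF_expand L ζ hz _ (m:ℤ)]
  rw [← Finset.mul_sum, Finset.sum_comm]
  simp_rw [Finset.sum_comm (s := Finset.range (3*L)), zsum _ _ hζ]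
  have : ∀ a ∈ Finset.range L, ∑ b ∈ Finset.range L, (if ((3*L : ℕ):ℤ) ∣ ((a:ℤ) - b - m) then ((3*L:ℕ):ℂ) else 0)
     = ∑ b ∈ Finset.range L, ((3*L:ℕ):ℂ) * (if a = b + m then 1 else 0) := by
    intro a ha
    apply Finset.sum_congr rfl; intro b hb
    rw [Finset.mem_range] at ha hb
    have : ((3*L : ℕ):ℤ) ∣ ((a:ℤ) - b - m) ↔ a = b + m := by
      constructor
      · rintro ⟨c, hc⟩
        have h1 : c < 1 := by
          by_contra h; push Not at h; push_cast at hc; nlinarith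
        have h2 : -1 < c := by
          by_contra h; push Not at h; push_cast at hc; nlinarith
        have : c = 0 := by omega
        subst this; simp at hc; omega
      · intro h; subst h; simp
    simp only [this]; split_ifs <;> simp
  rw [Finset.sum_congr rfl this]
  simp_rw [← Finset.mul_sum]
  rw [count_sum]
  have : (L:ℂ) ≠ 0 := by exact_mod_cast (by omega : L ≠ 0)
  push_cast; field_simp

lemma fej_sum' (L : ℕ) (hL : 1 ≤ L) (ζ : ℂ) (hz : ‖ζ‖ = 1) (hζ : IsPrimitiveRoot ζ (3*L)) (m : ℕ)
    (hm : m ≤ 2 * L) :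
    ∑ j ∈ Finset.range (3*L), (fejF L ζ j : ℂ) * (ζ ^ (m:ℤ)) ^ j = 3 * ((L - m : ℕ) : ℂ) := by
  have h := congrArg (starRingEnd ℂ) (fej_sum L hL ζ hz hζ m hm)
  rw [map_sum] at h
  have hc : (starRingEnd ℂ) ζ = ζ⁻¹ := by
    rw [Complex.inv_def, Complex.normSq_eq_norm_sq, hz]; simp
  have h3 : (starRingEnd ℂ) 3 = 3 := by rw [← Complex.ofReal_ofNat, Complex.conj_ofReal]
  simpa [hc, h3] using h

lemma bern_weights (L : ℕ) (hL : 1 ≤ L) : ∃ (t : ℕ → ℝ) (w : ℕ → ℂ),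
    ∑ j ∈ Finset.range (3*L), ‖w j‖ ≤ 2 * L ∧ ∀ k : ℤ, |k| ≤ L →
      ∑ j ∈ Finset.range (3*L), w j * Complex.exp (k * (t j) * Complex.I) = Complex.I * k := by
  set ζ : ℂ := Complex.exp (2 * Real.pi * Complex.I / ((3*L:ℕ):ℂ)) with hζd
  have hζ : IsPrimitiveRoot ζ (3*L) := Complex.isPrimitiveRoot_exp _ (by omega)
  have hz : ‖ζ‖ = 1 := hζ.norm'_eq_one (by omega)
  have h0 : ζ ≠ 0 := by intro h; simp [h] at hz
  have hLc : (L:ℂ) ≠ 0 := by exact_mod_cast (by omega : L ≠ 0)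
  refine ⟨fun j => j * (2 * Real.pi / (3*L : ℕ)),
    fun j => Complex.I / 3 * ((fejF L ζ j : ℂ) * ((ζ ^ (-(L:ℤ)))^j - (ζ ^ (L:ℤ))^j)), ?_, ?_⟩
  · have h1 := fej_sum L hL ζ hz hζ 0 (by omega)
    have h2 : ∑ j ∈ Finset.range (3*L), fejF L ζ j = 3 * L := by
      have : ((∑ j ∈ Finset.range (3*L), fejF L ζ j : ℝ) : ℂ) = ((3 * L : ℝ) : ℂ) := by
        push_cast; simpa using h1
      exact_mod_cast this
    calc _ ≤ ∑ j ∈ Finset.range (3*L), (2/3) * fejF L ζ j := by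
          apply Finset.sum_le_sum; intro j _
          rw [norm_mul, norm_mul, Complex.norm_real, Real.norm_of_nonneg (fejF_nonneg _ _ _)]
          have h3 : ‖(ζ ^ (-(L:ℤ)))^j - (ζ ^ (L:ℤ))^j‖ ≤ 2 := by
            refine (norm_sub_le _ _).trans ?_
            simp [hz]; norm_num
          have h4 : ‖Complex.I / 3‖ = 1/3 := by simp
          rw [h4]
          have := fejF_nonneg L ζ j
          nlinarith
      _ = 2 * L := by rw [← Finset.mul_sum, h2]; ring
  · intro k hk
    rw [abs_le] at hk
    have he : ∀ j : ℕ, Complex.exp (k * ((j * (2 * Real.pi / (3*L : ℕ)) : ℝ):ℂ) * Complex.I) = (ζ ^ k)^j := by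
      intro j
      rw [hζd, ← Complex.exp_int_mul, ← Complex.exp_nat_mul]
      congr 1
      push_cast; ring
    simp_rw [he]
    obtain ⟨m1, hm1⟩ := Int.eq_ofNat_of_zero_le (show 0 ≤ (L:ℤ) - k by linarith)
    obtain ⟨m2, hm2⟩ := Int.eq_ofNat_of_zero_le (show 0 ≤ (L:ℤ) + k by linarith)
    have h1 := fej_sum L hL ζ hz hζ m1 (by omega)
    have h2 := fej_sum' L hL ζ hz hζ m2 (by omega)
    have : ∀ j, Complex.I / 3 * ((fejF L ζ j : ℂ) * ((ζ ^ (-(L:ℤ)))^j - (ζ ^ (L:ℤ))^j)) * (ζ ^ k)^j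
       = Complex.I / 3 * ((fejF L ζ j : ℂ) * (ζ ^ (-(m1:ℤ))) ^ j - (fejF L ζ j : ℂ) * (ζ ^ (m2:ℤ)) ^ j) := by
      intro j
      have e1 : -(m1:ℤ) = -(L:ℤ) + k := by omega
      have e2 : (m2:ℤ) = (L:ℤ) + k := by omega
      rw [e1, e2, zpow_add₀ h0, zpow_add₀ h0, mul_pow, mul_pow]; ring
    simp_rw [this]
    rw [← Finset.mul_sum, Finset.sum_sub_distrib, h1, h2]
    have : (((L - m1 : ℕ):ℤ) - ((L - m2 : ℕ):ℤ) : ℤ) = k := by omega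
    have h3 : (((L - m1 : ℕ):ℂ) - ((L - m2 : ℕ):ℂ)) = k := by exact_mod_cast this
    rw [← h3]; ring

/-- trigonometric polynomials of degree at most `n` -/
def trigE (n : ℕ) : Submodule ℂ (ℝ → ℂ) :=
  Submodule.span ℂ {f | ∃ k : ℤ, |k| ≤ n ∧ f = fun θ : ℝ => Complex.exp (k * θ * Complex.I)}

lemma trigE_mul {a b : ℕ} {f g : ℝ → ℂ} (hf : f ∈ trigE a) (hg : g ∈ trigE b) :
    f * g ∈ trigE (a + b) := by
  have h := Submodule.mul_mem_mul hf hg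
  rw [trigE, trigE, Submodule.span_mul_span] at h
  refine Submodule.span_mono ?_ h
  rintro _ ⟨_, ⟨k, hk, rfl⟩, _, ⟨l, hl, rfl⟩, rfl⟩
  refine ⟨k + l, (abs_add_le k l).trans (by push_cast; linarith), ?_⟩
  funext θ
  simp only [Pi.mul_apply, ← Complex.exp_add]
  congr 1; push_cast; ring

lemma trigE_mono {a b : ℕ} (h : a ≤ b) : trigE a ≤ trigE b := by
  apply Submodule.span_mono
  rintro _ ⟨k, hk, rfl⟩
  exact ⟨k, hk.trans (by exact_mod_cast h), rfl⟩

lemma trigE_one : (1 : ℝ → ℂ) ∈ trigE 0 := by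
  apply Submodule.subset_span
  exact ⟨0, by simp, by funext; simp⟩

lemma trigE_pow {a : ℕ} {f : ℝ → ℂ} (hf : f ∈ trigE a) (n : ℕ) : f ^ n ∈ trigE (n * a) := by
  induction n with
  | zero => simpa using trigE_one
  | succ n ih => rw [pow_succ, Nat.succ_mul]; exact trigE_mul ih hf

lemma trigE_prod {ι : Type*} (s : Finset ι) (f : ι → ℝ → ℂ) (m : ι → ℕ)
    (hf : ∀ i, f i ∈ trigE (m i)) : ∏ i ∈ s, f i ∈ trigE (∑ i ∈ s, m i) := by
  classical
  induction s using Finset.induction_on with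
  | empty => simpa using trigE_one
  | insert i s hi ih => rw [Finset.prod_insert hi, Finset.sum_insert hi]; exact trigE_mul (hf i) ih

lemma trigE_const (c : ℂ) : (fun _ => c) ∈ trigE 0 := by
  have := (trigE 0).smul_mem c trigE_one
  convert this using 1
  funext; simp

lemma trigE_cos : (fun θ : ℝ => ((Real.cos θ : ℝ) : ℂ)) ∈ trigE 1 := by
  have h1 : (fun θ : ℝ => Complex.exp ((1:ℤ) * θ * Complex.I)) ∈ trigE 1 :=
    Submodule.subset_span ⟨1, by simp, rfl⟩
  have h2 : (fun θ : ℝ => Complex.exp ((-1:ℤ) * θ * Complex.I)) ∈ trigE 1 :=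
    Submodule.subset_span ⟨-1, by simp, rfl⟩
  convert (trigE 1).smul_mem (1/2) ((trigE 1).add_mem h1 h2) using 1
  funext θ
  simp [Complex.cos]; ring

lemma trigE_sin : (fun θ : ℝ => ((Real.sin θ : ℝ) : ℂ)) ∈ trigE 1 := by
  have h1 : (fun θ : ℝ => Complex.exp ((1:ℤ) * θ * Complex.I)) ∈ trigE 1 :=
    Submodule.subset_span ⟨1, by simp, rfl⟩
  have h2 : (fun θ : ℝ => Complex.exp ((-1:ℤ) * θ * Complex.I)) ∈ trigE 1 :=
    Submodule.subset_span ⟨-1, by simp, rfl⟩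
  convert (trigE 1).smul_mem (Complex.I/2) ((trigE 1).sub_mem h2 h1) using 1
  funext θ
  simp [Complex.sin]; ring

lemma trigE_eval {n : ℕ} (P : MvPolynomial (Fin n) ℝ) (L : ℕ) (hL : P.totalDegree ≤ L)
    (γ : ℝ → Fin n → ℝ) (hγ : ∀ i, (fun θ => ((γ θ i : ℝ) : ℂ)) ∈ trigE 1) :
    (fun θ => ((eval (γ θ) P : ℝ) : ℂ)) ∈ trigE L := by
  have : (fun θ => ((eval (γ θ) P : ℝ) : ℂ)) =
      ∑ m ∈ P.support, ((coeff m P : ℝ) : ℂ) • ∏ i, (fun θ => ((γ θ i : ℝ) : ℂ)) ^ (m i) := by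
    funext θ
    rw [eval_eq']
    simp
  rw [this]
  apply Submodule.sum_mem
  intro m hm
  apply Submodule.smul_mem
  have h1 := trigE_prod Finset.univ (fun i => (fun θ => ((γ θ i : ℝ) : ℂ)) ^ (m i)) (fun i => m i * 1)
    (fun i => trigE_pow (hγ i) _)
  refine trigE_mono ?_ h1
  refine le_trans ?_ ((le_totalDegree hm).trans hL)
  rw [Finsupp.sum_fintype _ _ (by simp)]
  simp

lemma trigE_deriv (L : ℕ) (t : ℕ → ℝ) (w : ℕ → ℂ)
    (h : ∀ k : ℤ, |k| ≤ L →
      ∑ j ∈ Finset.range (3*L), w j * Complex.exp (k * (t j) * Complex.I) = Complex.I * k)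
    (f : ℝ → ℂ) (hf : f ∈ trigE L) :
    HasDerivAt f (∑ j ∈ Finset.range (3*L), w j * f (t j)) 0 := by
  induction hf using Submodule.span_induction with
  | mem f hf =>
    obtain ⟨k, hk, rfl⟩ := hf
    rw [h k hk]
    have h1 : HasDerivAt (fun θ : ℝ => (k:ℂ) * (θ:ℂ) * Complex.I) ((k:ℂ) * 1 * Complex.I) 0 :=
      (((Complex.ofRealCLM.hasDerivAt (x := (0:ℝ))).const_mul (k:ℂ)).mul_const Complex.I)
    have := h1.cexp
    convert this using 1
    simp; ring
  | zero => simpa using hasDerivAt_const (0:ℝ) (0:ℂ)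
  | add f g _ _ hf hg =>
    refine (hf.add hg).congr_deriv ?_
    simp [mul_add, Finset.sum_add_distrib]
  | smul c f _ hf =>
    refine (hf.const_smul c).congr_deriv ?_
    simp [Finset.mul_sum]
    apply Finset.sum_congr rfl; intros; ring

lemma hasDerivAt_eval {n : ℕ} (P : MvPolynomial (Fin n) ℝ) (γ : ℝ → Fin n → ℝ) (γ' : Fin n → ℝ) (t : ℝ)
    (h : ∀ i, HasDerivAt (fun s => γ s i) (γ' i) t) :
    HasDerivAt (fun s => eval (γ s) P) (∑ i, γ' i * eval (γ t) (pderiv i P)) t := by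
  induction P using MvPolynomial.induction_on with
  | C a => simpa using hasDerivAt_const t a
  | add p q hp hq =>
    simp only [map_add, mul_add, Finset.sum_add_distrib]
    exact hp.add hq
  | mul_X p i hp =>
    simp only [map_mul, eval_X]
    refine (hp.mul (h i)).congr_deriv ?_
    simp only [Derivation.leibniz, pderiv_X, map_add, smul_eq_mul, map_mul, eval_X, mul_add,
      Finset.sum_add_distrib, Finset.sum_mul]
    rw [add_comm]
    congr 1
    · rw [Finset.sum_eq_single i]
      · simp; ring
      · intro j _ hj; simp [hj.symm]
      · simp
    · apply Finset.sum_congr rfl; intros; ring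

/-- action of an isometry on the sphere -/
def sphMap {d : ℕ} (A : Esp d ≃ₗᵢ[ℝ] Esp d) (x : Sph d) : Sph d :=
  ⟨A x, by simp⟩

lemma sphMap_cont {d : ℕ} (A : Esp d ≃ₗᵢ[ℝ] Esp d) : Continuous (sphMap A) := by
  unfold sphMap; fun_prop

open scoped Pointwise in
lemma sphMap_mp {d : ℕ} (A : Esp d ≃ₗᵢ[ℝ] Esp d) :
    MeasurePreserving (sphMap A) (sphMeasure d) (sphMeasure d) := by
  refine ⟨(sphMap_cont A).measurable, ?_⟩
  ext s hs
  have hm := (sphMap_cont A).measurable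
  rw [Measure.map_apply hm hs, sphMeasure, Measure.toSphere_apply' _ hs,
    Measure.toSphere_apply' _ (hm hs)]
  congr 1
  have hA : MeasurePreserving A (volume : Measure (Esp d)) volume := A.measurePreserving
  have hA2 : volume (A ⁻¹' (Set.Ioo (0:ℝ) 1 • (Subtype.val '' s))) = volume (Set.Ioo (0:ℝ) 1 • ((Subtype.val : Sph d → Esp d) '' s)) :=
    hA.measure_preimage_equiv (f := A.toMeasurableEquiv) _
  rw [← hA2]
  congr 1
  ext y
  simp only [Set.mem_smul, Set.mem_image, Set.mem_preimage]
  constructor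
  · rintro ⟨r, hr, _, ⟨x, hx, rfl⟩, rfl⟩
    exact ⟨r, hr, _, ⟨sphMap A x, hx, rfl⟩, by simp [sphMap]⟩
  · rintro ⟨r, hr, _, ⟨x, hx, rfl⟩, h⟩
    refine ⟨r, hr, _, ⟨sphMap A.symm x, ?_, rfl⟩, ?_⟩
    · have : sphMap A (sphMap A.symm x) = x := by ext; simp [sphMap]
      rwa [this]
    · apply A.injective
      simp only [sphMap, map_smul, LinearIsometryEquiv.apply_symm_apply]
      exact h

/-- rotation in the `i,j` plane -/
def rotFun {d : ℕ} (i j : Fin (d+1)) (θ : ℝ) (x : Fin (d+1) → ℝ) : Fin (d+1) → ℝ :=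
  fun k => if k = i then Real.cos θ * x i + Real.sin θ * x j
    else if k = j then - Real.sin θ * x i + Real.cos θ * x j else x k

def rotLin {d : ℕ} (i j : Fin (d+1)) (θ : ℝ) : Esp d →ₗ[ℝ] Esp d where
  toFun x := WithLp.toLp 2 (rotFun i j θ x)
  map_add' x y := by
    ext k; simp only [rotFun, PiLp.add_apply]; split_ifs <;> ring
  map_smul' c x := by
    ext k; simp only [rotFun, PiLp.smul_apply, smul_eq_mul, RingHom.id_apply]; split_ifs <;> ring

lemma rot_norm {d : ℕ} (i j : Fin (d+1)) (hij : i ≠ j) (θ : ℝ) (x : Esp d) :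
    ‖rotLin i j θ x‖ = ‖x‖ := by
  have : ‖rotLin i j θ x‖^2 = ‖x‖^2 := by
    rw [EuclideanSpace.norm_sq_eq, EuclideanSpace.norm_sq_eq]
    have hi : i ∈ Finset.univ.erase j := by simp [hij]
    rw [← Finset.add_sum_erase _ _ (Finset.mem_univ j), ← Finset.add_sum_erase _ _ hi,
      ← Finset.add_sum_erase (a := j) Finset.univ (fun k => ‖x k‖^2) (Finset.mem_univ j),
      ← Finset.add_sum_erase (a := i) (Finset.univ.erase j) (fun k => ‖x k‖^2) hi]
    have h1 : ∀ k ∈ (Finset.univ.erase j).erase i, ‖(rotLin i j θ x) k‖^2 = ‖x k‖^2 := by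
      intro k hk
      simp only [Finset.mem_erase, Finset.mem_univ, and_true] at hk
      simp [rotLin, rotFun, hk.1, hk.2]
    rw [Finset.sum_congr rfl h1]
    have hji := hij.symm
    simp only [rotLin, rotFun, LinearMap.coe_mk, AddHom.coe_mk, if_true, if_neg hji, Real.norm_eq_abs, sq_abs]
    have := Real.sin_sq_add_cos_sq θ
    linear_combination ((x i)^2 + (x j)^2) * this
  have h2 := norm_nonneg (rotLin i j θ x)
  have h3 := norm_nonneg x
  exact (sq_eq_sq₀ h2 h3).1 this

def rotIso {d : ℕ} (i j : Fin (d+1)) (hij : i ≠ j) (θ : ℝ) : Esp d ≃ₗᵢ[ℝ] Esp d :=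
  LinearIsometry.toLinearIsometryEquiv ⟨rotLin i j θ, rot_norm i j hij θ⟩ rfl

lemma rotIso_apply {d : ℕ} (i j : Fin (d+1)) (hij : i ≠ j) (θ : ℝ) (x : Sph d) (k : Fin (d+1)) :
    (sphMap (rotIso i j hij θ) x : Esp d) k = rotFun i j θ (x : Esp d) k := rfl

/-- evaluation on the sphere -/
abbrev ev {d : ℕ} (P : MvPolynomial (Fin (d+1)) ℝ) (x : Sph d) : ℝ := eval (fun i => (x : Esp d) i) P

lemma coord_cont {d : ℕ} : Continuous (fun x : Sph d => fun i => (x : Esp d) i) := by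
  fun_prop

lemma ev_cont {d : ℕ} (P : MvPolynomial (Fin (d+1)) ℝ) : Continuous (ev P) :=
  (MvPolynomial.continuous_eval P).comp coord_cont

lemma rot_deriv_bound {d : ℕ} (L : ℕ) (t : ℕ → ℝ) (w : ℕ → ℂ)
    (h : ∀ k : ℤ, |k| ≤ L →
      ∑ j ∈ Finset.range (3*L), w j * Complex.exp (k * (t j) * Complex.I) = Complex.I * k)
    (P : MvPolynomial (Fin (d+1)) ℝ) (hP : P.totalDegree ≤ L) (i j : Fin (d+1)) (hij : i ≠ j)
    (x : Sph d) :
    |(x : Esp d) j * ev (pderiv i P) x - (x : Esp d) i * ev (pderiv j P) x| ≤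
      ∑ l ∈ Finset.range (3*L), ‖w l‖ * |ev P (sphMap (rotIso i j hij (t l)) x)| := by
  set X : Fin (d+1) → ℝ := fun i => (x : Esp d) i with hX
  have h1 : (fun θ => ((eval (rotFun i j θ X) P : ℝ) : ℂ)) ∈ trigE L := by
    apply trigE_eval P L hP
    intro k
    simp only [rotFun]
    have c := trigE_cos
    have s := trigE_sin
    split_ifs
    · convert (trigE 1).add_mem ((trigE 1).smul_mem (X i : ℂ) c) ((trigE 1).smul_mem (X j : ℂ) s) using 1
      funext θ; simp; ring
    · convert (trigE 1).add_mem ((trigE 1).smul_mem (-X i : ℂ) s) ((trigE 1).smul_mem (X j : ℂ) c) using 1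
      funext θ; simp; ring
    · exact trigE_mono zero_le_one (trigE_const _)
  have h2 := trigE_deriv L t w h _ h1
  have h3 := hasDerivAt_eval P (fun θ => rotFun i j θ X)
    (fun k => if k = i then X j else if k = j then - X i else 0) 0 (by
      intro k
      simp only [rotFun]
      have c := Real.hasDerivAt_cos 0
      have s := Real.hasDerivAt_sin 0
      split_ifs
      · refine ((c.mul_const (X i)).add (s.mul_const (X j))).congr_deriv ?_
        simp
      · refine ((s.neg.mul_const (X i)).add (c.mul_const (X j))).congr_deriv ?_
        simp
      · exact hasDerivAt_const _ _)
  have h0 : rotFun i j 0 X = X := by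
    funext k; simp only [rotFun]; split_ifs with h1 h2
    · subst h1; simp
    · subst h2; simp
    · rfl
  have h4 : HasDerivAt (fun θ => ((eval (rotFun i j θ X) P : ℝ) : ℂ)) _ 0 := h3.ofReal_comp
  have h5 := h4.unique h2
  simp only [h0] at h5
  have h6 : ∑ k, (if k = i then X j else if k = j then - X i else 0) * eval X (pderiv k P)
      = X j * eval X (pderiv i P) - X i * eval X (pderiv j P) := by
    have : ∀ k, (if k = i then X j else if k = j then - X i else 0) * eval X (pderiv k P)
      = (if k = i then X j * eval X (pderiv i P) else 0) + (if k = j then - X i * eval X (pderiv j P) else 0) := by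
      intro k
      by_cases hki : k = i
      · rw [if_pos hki, if_pos hki, if_neg (fun h => hij (hki.symm.trans h)), hki, add_zero]
      · by_cases hkj : k = j
        · rw [if_neg hki, if_pos hkj, if_neg hki, if_pos hkj, hkj, zero_add]
        · rw [if_neg hki, if_neg hkj, if_neg hki, if_neg hkj, zero_mul, zero_add]
    simp only [this, Finset.sum_add_distrib]
    simp; ring
  rw [h6] at h5
  calc _ = ‖((X j * eval X (pderiv i P) - X i * eval X (pderiv j P) : ℝ) : ℂ)‖ := by
        rw [Complex.norm_real]; rfl
    _ ≤ _ := by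
        rw [h5]
        refine (norm_sum_le _ _).trans (Finset.sum_le_sum fun l _ => ?_)
        rw [norm_mul, Complex.norm_real]; rfl

lemma eLp_comp {d : ℕ} (A : Esp d ≃ₗᵢ[ℝ] Esp d) (q : ℝ≥0∞) (f : Sph d → ℝ) (hf : Continuous f) :
    eLpNorm (fun x => f (sphMap A x)) q (sphMeasure d) = eLpNorm f q (sphMeasure d) :=
  eLpNorm_comp_measurePreserving (f := sphMap A) hf.aestronglyMeasurable (sphMap_mp A)

lemma coord_le {d : ℕ} (x : Sph d) (i : Fin (d+1)) : |(x : Esp d) i| ≤ 1 := by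
  have := PiLp.norm_apply_le (x : Esp d) i
  have h2 : ‖(x : Esp d)‖ = 1 := by simp
  rw [h2] at this
  exact this

lemma coord_sq {d : ℕ} (x : Sph d) : ∑ i, ((x : Esp d) i)^2 = 1 := by
  have h2 : ‖(x : Esp d)‖^2 = 1 := by simp
  rw [EuclideanSpace.norm_sq_eq] at h2
  simpa using h2

lemma eLp_sum_le {d : ℕ} {ι : Type*} (s : Finset ι) (q : ℝ≥0∞) (hq : 1 ≤ q) (c : ι → ℝ) (hc : ∀ i, 0 ≤ c i)
    (f : ι → Sph d → ℝ) (hf : ∀ i, Continuous (f i)) :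
    eLpNorm (fun x => ∑ i ∈ s, c i * f i x) q (sphMeasure d) ≤
      ∑ i ∈ s, ENNReal.ofReal (c i) * eLpNorm (f i) q (sphMeasure d) := by
  have h1 : (fun x => ∑ i ∈ s, c i * f i x) = ∑ i ∈ s, (c i • f i) := by
    funext x; simp
  rw [h1]
  refine (eLpNorm_sum_le (fun i _ => ((hf i).const_smul (c i)).aestronglyMeasurable) hq).trans ?_
  apply Finset.sum_le_sum
  intro i _
  rw [eLpNorm_const_smul, Real.enorm_of_nonneg (hc i)]

lemma eLp_pderiv {d : ℕ} (L : ℕ) (hL : 1 ≤ L) (q : ℝ≥0∞) (hq : 1 ≤ q) (k : ℕ) (hk : k ≤ L)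
    (P : MvPolynomial (Fin (d+1)) ℝ) (hP : P.IsHomogeneous k) (i : Fin (d+1)) :
    eLpNorm (ev (d := d) (pderiv i P)) q (sphMeasure d) ≤
      ENNReal.ofReal ((2 * d + 3) * L) * eLpNorm (ev (d := d) P) q (sphMeasure d) := by
  obtain ⟨t, w, hw, h⟩ := bern_weights L hL
  have hdeg : P.totalDegree ≤ L := hP.totalDegree_le.trans hk
  set B : Fin (d+1) → Sph d → ℝ := fun j x => if hij : i ≠ j then
    ∑ l ∈ Finset.range (3*L), ‖w l‖ * |ev P (sphMap (rotIso i j hij (t l)) x)| else 0 with hB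
  have hBc : ∀ j, Continuous (B j) := by
    intro j
    by_cases hij : i ≠ j
    · simp only [hB, dif_pos hij]
      exact continuous_finsetSum _ fun l _ => continuous_const.mul ((ev_cont P).comp (sphMap_cont _)).abs
    · simp only [hB, dif_neg hij]; exact continuous_const
  have habs : ∀ f : Sph d → ℝ, eLpNorm (fun x => |f x|) q (sphMeasure d) = eLpNorm f q (sphMeasure d) :=
    fun f => eLpNorm_norm f
  have hBn : ∀ j, eLpNorm (B j) q (sphMeasure d) ≤ ENNReal.ofReal (2 * L) * eLpNorm (ev (d := d) P) q (sphMeasure d) := by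
    intro j
    by_cases hij : i ≠ j
    · simp only [hB, dif_pos hij]
      refine (eLp_sum_le _ q hq (fun l => ‖w l‖) (fun _ => norm_nonneg _)
        (fun l x => |ev P (sphMap (rotIso i j hij (t l)) x)|)
        (fun l => ((ev_cont P).comp (sphMap_cont _)).abs)).trans ?_
      have : ∀ l, eLpNorm (fun x => |ev P (sphMap (rotIso i j hij (t l)) x)|) q (sphMeasure d) =
          eLpNorm (ev (d := d) P) q (sphMeasure d) := by
        intro l
        rw [habs, eLp_comp _ q _ (ev_cont P)]
      simp only [this]
      rw [← Finset.sum_mul, ← ENNReal.ofReal_sum_of_nonneg (fun _ _ => norm_nonneg _)]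
      gcongr
    · simp only [hB, dif_neg hij]
      simp
  have hpt : ∀ x : Sph d, ‖ev (pderiv i P) x‖ ≤ (L : ℝ) * |ev P x| + ∑ j, 1 * B j x := by
    intro x
    set X : Fin (d+1) → ℝ := fun i => (x : Esp d) i with hX
    have eu := congrArg (eval X) hP.sum_X_mul_pderiv
    simp only [map_sum, map_mul, eval_X, nsmul_eq_mul, map_natCast] at eu
    have sq : ∑ j, (X j)^2 = 1 := coord_sq x
    have key : ev (pderiv i P) x = X i * (k * eval X P) +
        ∑ j, X j * (X j * eval X (pderiv i P) - X i * eval X (pderiv j P)) := by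
      rw [← eu]
      have : ∑ j, X j * (X j * eval X (pderiv i P) - X i * eval X (pderiv j P)) =
        (∑ j, (X j)^2) * eval X (pderiv i P) - X i * ∑ j, X j * eval X (pderiv j P) := by
        rw [Finset.sum_mul, Finset.mul_sum, ← Finset.sum_sub_distrib]
        apply Finset.sum_congr rfl; intros; ring
      rw [this, sq]; ring
    rw [key]
    refine (norm_add_le _ _).trans (add_le_add ?_ ?_)
    · rw [norm_mul, norm_mul]
      have h1 : ‖X i‖ ≤ 1 := coord_le x i
      have h2 : ‖(k:ℝ)‖ ≤ L := by simpa using hk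
      calc _ ≤ 1 * ((L:ℝ) * |ev P x|) := by
            gcongr
            exact le_rfl
        _ = _ := one_mul _
    · refine (norm_sum_le _ _).trans (Finset.sum_le_sum fun j _ => ?_)
      rw [norm_mul]
      have h1 : ‖X j‖ ≤ 1 := coord_le x j
      apply mul_le_mul h1 _ (norm_nonneg _) zero_le_one
      by_cases hij : i ≠ j
      · simp only [hB, dif_pos hij]
        exact rot_deriv_bound L t w h P hdeg i j hij x
      · push Not at hij
        subst hij
        simp [hB]
  refine (eLpNorm_mono_real hpt).trans ?_
  have hc1 : Continuous (fun x : Sph d => (L : ℝ) * |ev P x|) := continuous_const.mul (ev_cont P).abs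
  have hc2 : Continuous (fun x : Sph d => ∑ j, 1 * B j x) :=
    continuous_finsetSum _ fun j _ => continuous_const.mul (hBc j)
  refine (eLpNorm_add_le hc1.aestronglyMeasurable hc2.aestronglyMeasurable hq).trans ?_
  have e1 : eLpNorm (fun x : Sph d => (L : ℝ) * |ev P x|) q (sphMeasure d) ≤
      ENNReal.ofReal L * eLpNorm (ev (d := d) P) q (sphMeasure d) := by
    have := eLpNorm_const_smul_le (c := (L:ℝ)) (f := fun x : Sph d => |ev P x|) (p := q) (μ := sphMeasure d)
    rw [habs, Real.enorm_of_nonneg (by positivity)] at this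
    exact this
  have e2 := (eLp_sum_le Finset.univ q hq (fun _ => 1) (fun _ => zero_le_one) B hBc).trans
    (Finset.sum_le_sum fun j _ => mul_le_mul_right (hBn j) _)
  refine (add_le_add e1 e2).trans (le_of_eq ?_)
  simp only [ENNReal.ofReal_one, one_mul, Finset.sum_const, Finset.card_univ, Fintype.card_fin, nsmul_eq_mul]
  rw [← mul_assoc, ← add_mul]
  congr 1
  rw [← ENNReal.ofReal_natCast (d+1), ← ENNReal.ofReal_mul (by positivity), ← ENNReal.ofReal_add (by positivity) (by positivity)]
  congr 1; push_cast; ring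

lemma eLp_Gk {d : ℕ} (L : ℕ) (hL : 1 ≤ L) (q : ℝ≥0∞) (hq : 1 ≤ q) (m k : ℕ) (hk : k ≤ L)
    (P : MvPolynomial (Fin (d+1)) ℝ) (hP : P.IsHomogeneous k) :
    eLpNorm (fun x : Sph d => Gk m P (fun i => (x : Esp d) i)) q (sphMeasure d) ≤
      ENNReal.ofReal (((d+1) * ((2 * d + 3) * L))^m) * eLpNorm (ev (d := d) P) q (sphMeasure d) := by
  induction m generalizing P k with
  | zero =>
    simp only [Gk, pow_zero, ENNReal.ofReal_one, one_mul]
    exact (eLpNorm_norm (ev (d := d) P)).le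
  | succ m ih =>
    have h1 := eLp_sum_le Finset.univ q hq (fun _ => 1) (fun _ => zero_le_one)
      (fun (i : Fin (d+1)) (x : Sph d) => Gk m (pderiv i P) (fun i => (x : Esp d) i))
      (fun i => (Gk_cont m _).comp coord_cont)
    simp only [ENNReal.ofReal_one, one_mul] at h1
    simp only [Gk]
    refine h1.trans ?_
    have h2 : ∀ i ∈ (Finset.univ : Finset (Fin (d+1))), eLpNorm (fun x : Sph d => Gk m (pderiv i P) (fun i => (x : Esp d) i)) q (sphMeasure d) ≤
       ENNReal.ofReal (((d+1) * ((2 * d + 3) * L))^m) * (ENNReal.ofReal ((2 * d + 3) * L) * eLpNorm (ev (d := d) P) q (sphMeasure d)) := by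
      intro i _
      refine (ih (k-1) (by omega) (pderiv i P) hP.pderiv).trans ?_
      gcongr
      exact eLp_pderiv L hL q hq k hk P hP i
    refine (Finset.sum_le_sum h2).trans (le_of_eq ?_)
    simp only [Finset.sum_const, Finset.card_univ, Fintype.card_fin, nsmul_eq_mul]
    rw [← mul_assoc, ← mul_assoc]
    congr 1
    rw [← ENNReal.ofReal_natCast (d+1), ← ENNReal.ofReal_mul (by positivity), ← ENNReal.ofReal_mul (by positivity)]
    congr 1; push_cast; ring

lemma eLp_Phi {d : ℕ} (L : ℕ) (hL : 1 ≤ L) (q : ℝ≥0∞) (hq : 1 ≤ q) (k : ℕ) (hk : k ≤ L)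
    (δ : ℝ) (hδ : 0 ≤ δ) (hδL : δ * L ≤ 1)
    (P : MvPolynomial (Fin (d+1)) ℝ) (hP : P.IsHomogeneous k) :
    eLpNorm (fun x : Sph d => Phi L δ P (fun i => (x : Esp d) i)) q (sphMeasure d) ≤
      ENNReal.ofReal (Real.exp ((d+1) * (2*d+3))) * eLpNorm (ev (d := d) P) q (sphMeasure d) := by
  have h1 := eLp_sum_le (Finset.range (L+1)) q hq (fun m => (m.factorial : ℝ)⁻¹ * δ^m) (fun _ => by positivity)
      (fun m (x : Sph d) => Gk m P (fun i => (x : Esp d) i))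
      (fun i => (Gk_cont _ _).comp coord_cont)
  refine h1.trans ?_
  refine (Finset.sum_le_sum fun m _ => mul_le_mul_right (eLp_Gk L hL q hq m k hk P hP) _).trans ?_
  simp_rw [← mul_assoc (ENNReal.ofReal _) (ENNReal.ofReal _)]
  rw [← Finset.sum_mul]
  gcongr
  have h2 : ∀ m ∈ Finset.range (L+1), ENNReal.ofReal ((m.factorial : ℝ)⁻¹ * δ^m) * ENNReal.ofReal (((d+1) * ((2 * d + 3) * L))^m)
     ≤ ENNReal.ofReal (((d+1 : ℝ) * (2*d+3))^m / m.factorial) := by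
    intro m _
    rw [← ENNReal.ofReal_mul (by positivity)]
    apply ENNReal.ofReal_le_ofReal
    have e : (m.factorial : ℝ)⁻¹ * δ^m * ((d+1) * ((2 * d + 3) * L))^m = ((d+1 : ℝ) * (2*d+3))^m / m.factorial * (δ * L)^m := by
      simp only [mul_pow]; ring
    rw [e]
    exact mul_le_of_le_one_right (by positivity) (pow_le_one₀ (by positivity) hδL)
  refine (Finset.sum_le_sum h2).trans ?_
  rw [← ENNReal.ofReal_sum_of_nonneg (fun _ _ => by positivity)]
  exact ENNReal.ofReal_le_ofReal (Real.sum_le_exp_of_nonneg (by positivity) _)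

def rsq (d : ℕ) : MvPolynomial (Fin (d+1)) ℝ := ∑ i, X i ^ 2

lemma rsq_hom (d : ℕ) : (rsq d).IsHomogeneous 2 :=
  IsHomogeneous.sum _ _ _ fun i _ => by simpa using (isHomogeneous_X ℝ i).pow 2

lemma ev_rsq {d : ℕ} (x : Sph d) : ev (rsq d) x = 1 := by
  simp only [ev, rsq, map_sum, map_pow, eval_X]
  exact coord_sq x

lemma decomp (d L : ℕ) (hL : 1 ≤ L) (Q : Sph d → ℝ) (hQ : Q ∈ PiSp d L) :
    ∃ H1 H2 : MvPolynomial (Fin (d+1)) ℝ, H1.IsHomogeneous L ∧ H2.IsHomogeneous (L-1) ∧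
      ∀ x, Q x = ev H1 x + ev H2 x := by
  have key : PiSp d L ≤ (homogeneousSubmodule (Fin (d+1)) ℝ L).map (restrictSph d) ⊔
      (homogeneousSubmodule (Fin (d+1)) ℝ (L-1)).map (restrictSph d) := by
    refine iSup_le fun ℓ => ?_
    rintro _ ⟨P, hP, rfl⟩
    have hP1 : P.IsHomogeneous ℓ := hP.1
    have hm : ∀ j, restrictSph d (P * rsq d ^ j) = restrictSph d P := by
      intro j
      funext x
      show ev (P * rsq d ^ j) x = ev P x
      have := ev_rsq x
      simp only [ev] at this ⊢
      rw [map_mul, map_pow, this]; simp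
    have hl := ℓ.2
    rcases Nat.even_or_odd' (L - ℓ) with ⟨j, hj | hj⟩
    · apply Submodule.mem_sup_left
      refine ⟨P * rsq d ^ j, ?_, hm j⟩
      have := hP1.mul ((rsq_hom d).pow j)
      rw [show (ℓ:ℕ) + 2 * j = L by omega] at this
      exact this
    · apply Submodule.mem_sup_right
      refine ⟨P * rsq d ^ j, ?_, hm j⟩
      have := hP1.mul ((rsq_hom d).pow j)
      rw [show (ℓ:ℕ) + 2 * j = L - 1 by omega] at this
      exact this
  obtain ⟨_, ⟨H1, h1, rfl⟩, _, ⟨H2, h2, rfl⟩, h⟩ := Submodule.mem_sup.1 (key hQ)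
  exact ⟨H1, H2, h1, h2, fun x => (congrFun h x).symm⟩

lemma hom_neg {d k : ℕ} (H : MvPolynomial (Fin (d+1)) ℝ) (hH : H.IsHomogeneous k) (x : Sph d) :
    ev H (sphMap (LinearIsometryEquiv.neg ℝ) x) = (-1)^k * ev H x := by
  have h2 : (fun i => ((sphMap (LinearIsometryEquiv.neg ℝ) x : Sph d) : Esp d) i) = fun i => (-1) * (x : Esp d) i := by
    funext i; simp [sphMap]
  simp only [ev]
  rw [h2, eval_eq', eval_eq', Finset.mul_sum]
  apply Finset.sum_congr rfl
  intro m hm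
  have h3 : ∑ i, m i = k := by
    have := hH (mem_support_iff.1 hm)
    rw [← this, Finsupp.weight_apply, Finsupp.sum_fintype _ _ (by simp)]
    simp
  simp only [mul_pow, Finset.prod_mul_distrib]
  rw [Finset.prod_pow_eq_pow_sum, h3]
  ring

lemma half_norm {d : ℕ} (q : ℝ≥0∞) (hq : 1 ≤ q) (Q : Sph d → ℝ) (hQ : Continuous Q)
    (s : ℝ) (hs : |s| = 1) :
    eLpNorm (fun x => (1/2 : ℝ) * (Q x + s * Q (sphMap (LinearIsometryEquiv.neg ℝ) x))) q (sphMeasure d)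
      ≤ eLpNorm Q q (sphMeasure d) := by
  have hc2 : Continuous (fun x => Q (sphMap (LinearIsometryEquiv.neg ℝ) x)) := hQ.comp (sphMap_cont _)
  have e : (fun x => (1/2 : ℝ) * (Q x + s * Q (sphMap (LinearIsometryEquiv.neg ℝ) x)))
    = (1/2 : ℝ) • (Q + s • (fun x => Q (sphMap (LinearIsometryEquiv.neg ℝ) x))) := by
    funext x; simp
  rw [e, eLpNorm_const_smul]
  have h1 := eLpNorm_add_le (μ := sphMeasure d) (p := q) hQ.aestronglyMeasurable (hc2.const_smul s).aestronglyMeasurable hq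
  change _ ≤ eLpNorm Q q _ + eLpNorm (s • (fun x => Q (sphMap (LinearIsometryEquiv.neg ℝ) x))) q _ at h1
  rw [eLpNorm_const_smul, eLp_comp _ q Q hQ] at h1
  have hs' : ‖s‖ₑ = 1 := by
    rw [← ofReal_norm, Real.norm_eq_abs, hs, ENNReal.ofReal_one]
  rw [hs', one_mul] at h1
  have hh : ‖(1/2:ℝ)‖ₑ = 2⁻¹ := by
    rw [Real.enorm_of_nonneg (by norm_num), one_div, ENNReal.ofReal_inv_of_pos (by norm_num)]; simp
  rw [hh]
  refine (mul_le_mul_right h1 _).trans (le_of_eq ?_)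
  rw [← two_mul, ← mul_assoc, ENNReal.inv_mul_cancel (by simp) (by simp), one_mul]

lemma decomp_norm (d L : ℕ) (hL : 1 ≤ L) (q : ℝ≥0∞) (hq : 1 ≤ q) (Q : Sph d → ℝ)
    (H1 H2 : MvPolynomial (Fin (d+1)) ℝ) (h1 : H1.IsHomogeneous L) (h2 : H2.IsHomogeneous (L-1))
    (h : ∀ x, Q x = ev H1 x + ev H2 x) :
    eLpNorm (ev (d := d) H1) q (sphMeasure d) ≤ eLpNorm Q q (sphMeasure d) ∧
    eLpNorm (ev (d := d) H2) q (sphMeasure d) ≤ eLpNorm Q q (sphMeasure d) := by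
  have hQ : Continuous Q := by
    rw [funext h]; exact (ev_cont H1).add (ev_cont H2)
  obtain ⟨m, rfl⟩ := Nat.exists_eq_add_of_le' hL
  rw [Nat.add_sub_cancel] at h2
  have hsq : ((-1:ℝ)^m) * (-1)^m = 1 := by rw [← mul_pow]; simp
  constructor
  · have := half_norm q hq Q hQ ((-1)^(m+1)) (by simp [abs_pow])
    convert this using 2
    funext x
    rw [h, h, hom_neg H1 h1, hom_neg H2 h2, pow_succ]
    linear_combination (1/2 * ev H2 x - 1/2 * ev H1 x) * hsq
  · have := half_norm q hq Q hQ ((-1)^m) (by simp [abs_pow])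
    convert this using 2
    funext x
    rw [h, h, hom_neg H1 h1, hom_neg H2 h2, pow_succ]
    linear_combination (1/2 * ev H1 x - 1/2 * ev H2 x) * hsq

lemma pow_diff_le (η : ℝ) (h0 : 0 ≤ η) (h1 : η ≤ 1) (n : ℕ) :
    (1+η)^n ≤ (1-η)^n + 2 * η * n * 2^n := by
  induction n with
  | zero => simp
  | succ n ih =>
    have e1 : (1-η)^n ≤ 1 := pow_le_one₀ (by linarith) (by linarith)
    have e2 : (1:ℝ) ≤ 2^n := one_le_pow₀ (by norm_num)
    have e3 : (0:ℝ) ≤ (1-η)^n := pow_nonneg (by linarith) n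
    have e4 : 0 ≤ 2 * η * n * 2^n := by positivity
    rw [pow_succ, pow_succ, pow_succ]; push_cast
    calc (1+η)^n * (1+η) ≤ ((1-η)^n + 2 * η * n * 2^n) * (1+η) := by gcongr
      _ = (1-η)^n * (1-η) + 2 * η * (1-η)^n + 2 * η * n * 2^n * (1+η) := by ring
      _ ≤ (1-η)^n * (1-η) + 2 * η * 1 + 2 * η * n * 2^n * (1+1) := by gcongr
      _ ≤ (1-η)^n * (1-η) + 2 * η * (2^n*2) + 2 * η * n * 2^n * (1+1) := by gcongr; linarith
      _ = _ := by ring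

open scoped Pointwise in
lemma cap_lower (d : ℕ) : ∃ c : ℝ, 0 < c ∧ ∀ (z : Sph d) (δ : ℝ), 0 < δ → δ ≤ 1 →
    c * δ^d ≤ (sphMeasure d).real (Metric.ball z δ) := by
  set vB : ℝ := (volume : Measure (Esp d)).real (Metric.ball 0 1) with hvB
  have hvB0 : 0 < vB := ENNReal.toReal_pos (Metric.measure_ball_pos _ _ one_pos).ne' measure_ball_lt_top.ne
  refine ⟨vB / (2^(d+2) * 4^d), by positivity, fun z δ h0 h1 => ?_⟩
  set s := Metric.ball z δ with hs
  set T : Set (Esp d) := Set.Ioo (0:ℝ) 1 • (Subtype.val '' s) with hT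
  set η := δ / 4 with hη
  have hη0 : 0 < η := by positivity
  have hη1 : η ≤ 1/4 := by rw [hη]; linarith
  have hfr : Module.finrank ℝ (Esp d) = d + 1 := by simp
  have hTn : ∀ y ∈ T, ‖y‖ < 1 := by
    rintro _ ⟨r, hr, _, ⟨x, hx, rfl⟩, rfl⟩
    have : ‖(x : Esp d)‖ = 1 := by simp
    simp only [norm_smul, this, mul_one, Real.norm_eq_abs, abs_of_pos hr.1]
    exact hr.2
  have hTfin : volume T ≠ ⊤ := by
    refine ((measure_mono (fun y hy => ?_)).trans_lt (measure_ball_lt_top (x := (0 : Esp d)) (r := 1))).ne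
    simpa using hTn y hy
  have hscale : ∀ r : ℝ, 0 ≤ r → (volume : Measure (Esp d)).real (r • T) = r^(d+1) * (volume : Measure (Esp d)).real T := by
    intro r hr
    rw [measureReal_def, Measure.addHaar_smul, hfr, abs_of_nonneg (by positivity), ENNReal.toReal_mul,
      ENNReal.toReal_ofReal (by positivity), measureReal_def]
  have hball : (volume : Measure (Esp d)).real (Metric.ball (z : Esp d) η) = η^(d+1) * vB := by
    rw [measureReal_def, Measure.addHaar_ball _ _ hη0.le, hfr, ENNReal.toReal_mul,
      ENNReal.toReal_ofReal (by positivity), hvB, measureReal_def]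
  have hzn : ‖(z : Esp d)‖ = 1 := by simp
  have hsub : Metric.ball (z : Esp d) η ∪ (1-η) • T ⊆ (1+η) • T := by
    rintro y (hy | hy)
    · rw [Metric.mem_ball, dist_eq_norm] at hy
      have n1 : |‖y‖ - 1| < η := by
        have := abs_norm_sub_norm_le y (z : Esp d)
        rw [hzn] at this; linarith
      rw [abs_lt] at n1
      have n0 : 0 < ‖y‖ := by linarith [n1.1]
      have hu : ‖(‖y‖⁻¹ • y)‖ = 1 := by
        rw [norm_smul, norm_inv, norm_norm, inv_mul_cancel₀ n0.ne']
      refine ⟨(‖y‖/(1+η)) • (‖y‖⁻¹ • y), ⟨‖y‖/(1+η), ⟨by positivity, ?_⟩, _, ⟨⟨‖y‖⁻¹ • y, by simpa using hu⟩, ?_, rfl⟩, rfl⟩, ?_⟩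
      · rw [div_lt_one (by linarith)]; linarith [n1.2]
      · rw [hs, Metric.mem_ball, Subtype.dist_eq, dist_eq_norm]
        have t1 : ‖‖y‖⁻¹ • y - y‖ = |1 - ‖y‖| := by
          have : ‖y‖⁻¹ • y - y = (1 - ‖y‖) • (‖y‖⁻¹ • y) := by
            rw [sub_smul, one_smul, smul_smul, mul_inv_cancel₀ n0.ne', one_smul]
          rw [this, norm_smul, hu, mul_one, Real.norm_eq_abs]
        have t2 : |1 - ‖y‖| < η := by rw [abs_lt]; constructor <;> linarith [n1.1, n1.2]
        have t3 := norm_sub_le_norm_sub_add_norm_sub (‖y‖⁻¹ • y) y (z : Esp d)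
        simp only
        linarith
      · simp only [smul_smul]
        rw [show (1+η) * (‖y‖/(1+η)*‖y‖⁻¹) = 1 by field_simp, one_smul]
    · obtain ⟨_, ⟨r, hr, u, hu, rfl⟩, rfl⟩ := hy
      refine ⟨((1-η)/(1+η) * r) • u, ⟨_, ⟨?_, ?_⟩, u, hu, rfl⟩, ?_⟩
      · have := hr.1
        have : 0 < 1 - η := by linarith
        positivity
      · have : (1-η)/(1+η) ≤ 1 := by rw [div_le_one (by linarith)]; linarith
        have t : 0 ≤ (1-η)/(1+η) := div_nonneg (by linarith) (by linarith)
        nlinarith [hr.1, hr.2]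
      · simp only [smul_smul]
        congr 1
        field_simp
  have hdisj : Disjoint (Metric.ball (z : Esp d) η) ((1-η) • T) := by
    rw [Set.disjoint_left]
    rintro _ hy ⟨y, hyT, rfl⟩
    rw [Metric.mem_ball, dist_eq_norm] at hy
    have t1 := hTn y hyT
    have t2 := norm_sub_norm_le (z : Esp d) ((1-η) • y)
    rw [norm_sub_rev] at hy
    simp only at hy
    rw [hzn, norm_smul, Real.norm_eq_abs, abs_of_pos (by linarith)] at t2
    nlinarith
  have hfin2 : ∀ r : ℝ, volume (r • T) ≠ ⊤ := fun r => by
    rw [Measure.addHaar_smul]; exact ENNReal.mul_ne_top (by simp) hTfin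
  have main : η^(d+1) * vB + (1-η)^(d+1) * (volume : Measure (Esp d)).real T ≤ (1+η)^(d+1) * (volume : Measure (Esp d)).real T := by
    rw [← hball, ← hscale _ (by linarith), ← hscale _ (by linarith),
      ← measureReal_union' hdisj Metric.isOpen_ball.measurableSet measure_ball_lt_top.ne (hfin2 _)]
    exact measureReal_mono hsub (hfin2 _)
  have pd := pow_diff_le η hη0.le (by linarith) (d+1)
  have hT0 : 0 ≤ (volume : Measure (Esp d)).real T := measureReal_nonneg
  have hσ : (sphMeasure d).real s = (d+1) * (volume : Measure (Esp d)).real T := by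
    rw [measureReal_def, sphMeasure, Measure.toSphere_apply' _ Metric.isOpen_ball.measurableSet, hfr, ENNReal.toReal_mul]
    rw [ENNReal.toReal_natCast, measureReal_def]
    push_cast; rfl
  rw [hσ]
  have m2 : η^(d+1) * vB ≤ 2 * η * ((d+1 : ℕ):ℝ) * 2^(d+1) * (volume : Measure (Esp d)).real T := by
    nlinarith
  have m3 : η^d * vB ≤ 2^(d+2) * ((d+1) * (volume : Measure (Esp d)).real T) := by
    have : η * (η^d * vB) ≤ η * (2^(d+2) * ((d+1) * (volume : Measure (Esp d)).real T)) := by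
      calc _ = η^(d+1) * vB := by ring
        _ ≤ _ := m2
        _ = _ := by push_cast; ring
    exact le_of_mul_le_mul_left this hη0
  have e : vB / (2^(d+2) * 4^d) * δ^d = (η^d * vB) / 2^(d+2) := by
    rw [hη, div_pow]; field_simp
  rw [e, div_le_iff₀ (by positivity)]
  linarith

lemma coeff_polyLap (d : ℕ) (m : Fin (d+1) →₀ ℕ) :
    ∃ c : Fin (d+1) → ℝ, ∀ P : MvPolynomial (Fin (d+1)) ℝ, coeff m (polyLap d P) = ∑ i, coeff (m + Finsupp.single i 1 + Finsupp.single i 1) P * c i := by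
  refine ⟨fun i => ((m + Finsupp.single i 1 : Fin (d+1) →₀ ℕ) i + 1) * (m i + 1), fun P => ?_⟩
  rw [eval_polyLap, coeff_sum]
  simp only [coeff_pderiv, mul_assoc]

lemma polyLap_hc (d : ℕ) (P : MvPolynomial (Fin (d+1)) ℝ) (hP : polyLap d P = 0) (k : ℕ) :
    polyLap d (homogeneousComponent k P) = 0 := by
  ext m
  obtain ⟨c, hc⟩ := coeff_polyLap d m
  have h1 := hc P
  rw [hP] at h1
  rw [hc]
  simp only [coeff_homogeneousComponent]
  have hd : ∀ i : Fin (d+1), (m + Finsupp.single i 1 + Finsupp.single i 1).degree = m.degree + 2 := by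
    intro i; simp [map_add]; 
  simp only [hd]
  by_cases h : m.degree + 2 = k
  · simp only [if_pos h, ← h1]
  · simp only [if_neg h]; simp

lemma hc_sum_mem (d L : ℕ) (P : MvPolynomial (Fin (d+1)) ℝ) (hP : polyLap d P = 0)
    (hL : P.totalDegree ≤ L) : restrictSph d P ∈ PiSp d L := by
  rw [← sum_homogeneousComponent P, map_sum]
  apply Submodule.sum_mem
  intro k hk
  have hk' : k < L + 1 := by have := Finset.mem_range.1 hk; omega
  refine Submodule.mem_iSup_of_mem (⟨k, hk'⟩ : Fin (L+1)) ?_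
  exact ⟨_, ⟨homogeneousComponent_isHomogeneous k P, polyLap_hc d P hP k⟩, rfl⟩

def SV (d L : ℕ) : Set (Fin (d+1) →₀ ℕ) := {n | n.degree ≤ L}
def SW (d L : ℕ) : Set (Fin (d+1) →₀ ℕ) := {n | n.degree + 2 ≤ L}
def SE (d L : ℕ) : Set (Fin (d+1) →₀ ℕ) := {n | n.degree = L}

lemma SV_fin (d L : ℕ) : (SV d L).Finite := Finsupp.finite_of_degree_le L

lemma SE_card (d L : ℕ) (hd : 1 ≤ d) : (L / d + 1)^d ≤ (SE d L).ncard := by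
  have hf : (SE d L).Finite := (SV_fin d L).subset fun n hn => le_of_eq hn
  have hb : ∀ f : Fin d → Fin (L/d+1), ∑ i, (f i : ℕ) ≤ L := by
    intro f
    calc ∑ i, (f i : ℕ) ≤ ∑ i : Fin d, L / d := Finset.sum_le_sum fun i _ => Nat.lt_succ_iff.1 (f i).2
      _ = d * (L/d) := by simp
      _ ≤ L := Nat.mul_div_le L d
  let g : (Fin d → Fin (L/d+1)) → SE d L := fun f =>
    ⟨Finsupp.equivFunOnFinite.symm (Fin.cons (L - ∑ i, (f i : ℕ)) (fun i => (f i : ℕ))), by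
      show Finsupp.degree _ = L
      rw [Finsupp.degree_eq_sum, Fin.sum_univ_succ]
      have := hb f
      simp; omega⟩
  have hg : Function.Injective g := by
    intro f f' h
    have h2 := congrArg (fun x => (Finsupp.equivFunOnFinite x.1 : Fin (d+1) → ℕ)) h
    funext i
    have h3 := congrFun h2 i.succ
    simp [g] at h3
    exact Fin.ext h3
  have := hf.to_subtype
  have := Nat.card_le_card_of_injective g hg
  simpa using this

lemma finrank_rs (d : ℕ) (S : Set (Fin (d+1) →₀ ℕ)) :
    Module.finrank ℝ (restrictSupport ℝ S) = S.ncard := by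
  rw [Module.finrank_eq_nat_card_basis (basisRestrictSupport ℝ S)]; rfl

lemma dim_lower (d L : ℕ) (hd : 1 ≤ d) : (L/d+1)^d ≤ Module.finrank ℝ (PiSp d L) := by
  have : Finite (SV d L) := (SV_fin d L).to_subtype
  have hSW : SW d L ⊆ SV d L := fun n (hn : _ + 2 ≤ L) => (by show _ ≤ L; omega)
  have hSE : SE d L ⊆ SV d L := fun n hn => le_of_eq hn
  have : Finite (SW d L) := ((SV_fin d L).subset hSW).to_subtype
  have fV : Module.Finite ℝ (restrictSupport ℝ (SV d L)) := Module.Finite.of_basis (basisRestrictSupport ℝ (SV d L))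
  have fW : Module.Finite ℝ (restrictSupport ℝ (SW d L)) := Module.Finite.of_basis (basisRestrictSupport ℝ (SW d L))
  have hle : PiSp d L ≤ (restrictSupport ℝ (SV d L)).map (restrictSph d) := by
    refine iSup_le fun ℓ => Submodule.map_mono ?_
    intro P hP m hm
    have h1 : P.IsHomogeneous ℓ := hP.1
    have := h1 (mem_support_iff.1 hm)
    show m.degree ≤ L
    have h2 : m.degree = ℓ := by rw [Finsupp.degree_eq_weight_one]; exact this
    have := ℓ.2; omega
  have : Module.Finite ℝ (PiSp d L) := Submodule.finiteDimensional_of_le hle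
  set f := (polyLap d).domRestrict (restrictSupport ℝ (SV d L)) with hf
  have hr : LinearMap.range f ≤ restrictSupport ℝ (SW d L) := by
    rintro _ ⟨⟨P, hP⟩, rfl⟩ m hm
    replace hm : coeff m (polyLap d P) ≠ 0 := mem_support_iff.1 hm
    obtain ⟨c, hc⟩ := coeff_polyLap d m
    rw [hc] at hm
    obtain ⟨i, -, hi⟩ := Finset.exists_ne_zero_of_sum_ne_zero hm
    have h1 : (m + Finsupp.single i 1 + Finsupp.single i 1) ∈ SV d L :=
      hP (mem_support_iff.2 (left_ne_zero_of_mul hi))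
    have h2 : (m + Finsupp.single i 1 + Finsupp.single i 1).degree ≤ L := h1
    show m.degree + 2 ≤ L
    simp [map_add] at h2
    omega
  have h1 := LinearMap.finrank_range_add_finrank_ker f
  have h2 := Submodule.finrank_mono hr
  have hk : ∀ P : LinearMap.ker f, restrictSph d P.1.1 ∈ PiSp d L := by
    rintro ⟨⟨P, hP⟩, hP2⟩
    apply hc_sum_mem d L P hP2
    apply Finset.sup_le
    intro m hm
    have : m.degree ≤ L := hP hm
    exact this
  have h3 : Module.finrank ℝ (LinearMap.ker f) ≤ Module.finrank ℝ (PiSp d L) := by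
    apply LinearMap.finrank_le_finrank_of_injective
      (f := LinearMap.codRestrict (PiSp d L) (restrictSph d ∘ₗ (Submodule.subtype _) ∘ₗ (Submodule.subtype _)) hk)
    rw [injective_iff_map_eq_zero]
    rintro ⟨⟨P, hP⟩, hP2⟩ h0
    have h4 : restrictSph d P = 0 := congrArg Subtype.val h0
    have h5 : P = 0 := polyHarm_eq_zero d P hP2 (fun x hx => congrFun h4 ⟨x, by simpa using hx⟩)
    subst h5; rfl
  rw [finrank_rs] at h1 h2
  have h4 : (SW d L).ncard + (SE d L).ncard ≤ (SV d L).ncard := by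
    have hdis : Disjoint (SW d L) (SE d L) := by
      rw [Set.disjoint_left]
      intro n h h2
      change n.degree + 2 ≤ L at h
      change n.degree = L at h2
      omega
    rw [← Set.ncard_union_eq hdis
      ((SV_fin d L).subset hSW) ((SV_fin d L).subset hSE)]
    exact Set.ncard_le_ncard (Set.union_subset hSW hSE) (SV_fin d L)
  have h5 := SE_card d L hd
  omega

lemma dim_lower' (d L : ℕ) (hd : 1 ≤ d) : (L:ℝ)^d / d^d ≤ Module.finrank ℝ (PiSp d L) := by
  have h1 := dim_lower d L hd
  have h2 : L ≤ d * (L/d+1) := (Nat.lt_mul_div_succ L (by omega)).le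
  have hd0 : (0:ℝ) < d := by exact_mod_cast hd
  have h3 : (L:ℝ)/d ≤ ((L/d+1 : ℕ) : ℝ) := by
    rw [div_le_iff₀ hd0, mul_comm]; exact_mod_cast h2
  rw [← div_pow]
  calc ((L:ℝ)/d)^d ≤ ((L/d+1 : ℕ) : ℝ)^d := by gcongr
    _ ≤ _ := by exact_mod_cast h1

lemma chord_lower {d : ℕ} (z w : Sph d) (s : ℝ) (h0 : 0 ≤ s) (h1 : s ≤ 1) (h : s ≤ gdist d z w) :
    s / 2 ≤ dist z w := by
  have hz : ‖(z : Esp d)‖ = 1 := by simp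
  have hw : ‖(w : Esp d)‖ = 1 := by simp
  have hin := abs_real_inner_le_norm (z : Esp d) (w : Esp d)
  rw [hz, hw, mul_one, abs_le] at hin
  have hcos : ⟪(z : Esp d), (w : Esp d)⟫ ≤ Real.cos s := by
    rw [← Real.cos_arccos hin.1 hin.2]
    exact Real.cos_le_cos_of_nonneg_of_le_pi h0 (Real.arccos_le_pi _) h
  have hb := (abs_le.1 (Real.cos_bound (x := s) (by rw [abs_of_nonneg h0]; exact h1))).2
  rw [abs_of_nonneg h0] at hb
  have hs4 : s^4 ≤ s^2 := pow_le_pow_of_le_one h0 h1 (by norm_num)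
  have hd : dist z w ^ 2 = 2 - 2 * ⟪(z : Esp d), (w : Esp d)⟫ := by
    rw [Subtype.dist_eq, dist_eq_norm, @norm_sub_sq_real, hz, hw]; ring
  refine (sq_le_sq₀ (by positivity) dist_nonneg).1 ?_
  rw [hd]
  nlinarith [sq_nonneg s]

instance sphFin (d : ℕ) : IsFiniteMeasure (sphMeasure d) := by
  unfold sphMeasure; infer_instance

lemma cont_int {d : ℕ} (f : Sph d → ℝ) (hf : Continuous f) : Integrable f (sphMeasure d) :=
  hf.integrable_of_hasCompactSupport (HasCompactSupport.of_compactSpace f)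

lemma int_of_eLp {d : ℕ} (p : ℝ) (hp : 1 ≤ p) (F Q : Sph d → ℝ) (hF : Continuous F) (hQ : Continuous Q)
    (K : ℝ) (hK : 0 ≤ K)
    (h : eLpNorm F (ENNReal.ofReal p) (sphMeasure d) ≤ ENNReal.ofReal K * eLpNorm Q (ENNReal.ofReal p) (sphMeasure d)) :
    ∫ x, |F x|^p ∂(sphMeasure d) ≤ K^p * ∫ x, |Q x|^p ∂(sphMeasure d) := by
  have hp0 : 0 < p := by linarith
  have e1 : ENNReal.ofReal p ≠ 0 := by simpa using hp0
  have hm : ∀ f : Sph d → ℝ, Continuous f → MemLp f (ENNReal.ofReal p) (sphMeasure d) := fun f hf =>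
    hf.memLp_of_hasCompactSupport (HasCompactSupport.of_compactSpace f)
  rw [(hm F hF).eLpNorm_eq_integral_rpow_norm e1 ENNReal.ofReal_ne_top,
    (hm Q hQ).eLpNorm_eq_integral_rpow_norm e1 ENNReal.ofReal_ne_top, ENNReal.toReal_ofReal hp0.le,
    ← ENNReal.ofReal_mul hK] at h
  simp only [Real.norm_eq_abs] at h
  have i1 : 0 ≤ ∫ x, |F x|^p ∂(sphMeasure d) := integral_nonneg fun x => by positivity
  have i2 : 0 ≤ ∫ x, |Q x|^p ∂(sphMeasure d) := integral_nonneg fun x => by positivity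
  rw [ENNReal.ofReal_le_ofReal_iff (by positivity)] at h
  have h2 := Real.rpow_le_rpow (by positivity) h hp0.le
  rwa [Real.mul_rpow hK (by positivity), Real.rpow_inv_rpow i1 hp0.ne', Real.rpow_inv_rpow i2 hp0.ne'] at h2

lemma sum_caps {d : ℕ} (N : ℕ) (S : Finset (Sph d)) (δ : ℝ) (color : {z : Sph d // z ∈ S} → Fin N)
    (hsep : ∀ z w : {z : Sph d // z ∈ S}, z ≠ w → color z = color w → δ + δ ≤ dist z.1 w.1)
    (f : Sph d → ℝ) (hf : Continuous f) (hf0 : ∀ x, 0 ≤ f x) :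
    ∑ z ∈ S, ∫ x in Metric.ball z δ, f x ∂(sphMeasure d) ≤ N * ∫ x, f x ∂(sphMeasure d) := by
  rw [← Finset.sum_coe_sort S, ← Finset.sum_fiberwise Finset.univ color]
  have : ∀ j ∈ (Finset.univ : Finset (Fin N)), ∑ z : {z // z ∈ S} with color z = j, ∫ x in Metric.ball z.1 δ, f x ∂(sphMeasure d) ≤ ∫ x, f x ∂(sphMeasure d) := by
    intro j _
    rw [← integral_biUnion_finset]
    · exact setIntegral_le_integral (cont_int f hf) (Filter.Eventually.of_forall hf0)
    · intro i _; exact Metric.isOpen_ball.measurableSet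
    · intro z hz w hw hne
      simp at hz hw
      exact Metric.ball_disjoint_ball (hsep z w hne (hz.trans hw.symm))
    · intro i _; exact (cont_int f hf).integrableOn
  refine (Finset.sum_le_sum this).trans (le_of_eq ?_)
  simp

/-- If each `Z(L)` is a union of at most `N` subsets, each `ε/(L+1)`-separated in geodesic
distance, then the discrete part of the Marcinkiewicz–Zygmund inequality holds:
`(1/π_L) Σ_{z ∈ Z(L)} |Q(z)|^p ≤ C ∫ |Q|^p dσ` for all `Q ∈ Π_L`. -/
theorem stmt16 (d : ℕ) (hd : 1 ≤ d) (p : ℝ) (hp : 1 ≤ p) (N : ℕ) (ε : ℝ) (hε : 0 < ε)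
    (Z : ℕ → Finset (Sph d))
    (hsep : ∀ L : ℕ, ∃ color : {z : Sph d // z ∈ Z L} → Fin N,
      ∀ z w : {z : Sph d // z ∈ Z L}, z ≠ w → color z = color w →
        ε / (L + 1) ≤ gdist d z.1 w.1) :
    ∃ C : ℝ, 0 < C ∧ ∀ L : ℕ, 1 ≤ L → ∀ Q ∈ PiSp d L,
      ((Module.finrank ℝ (PiSp d L) : ℝ))⁻¹ * ∑ z ∈ Z L, |Q z| ^ p
        ≤ C * ∫ z, |Q z| ^ p ∂(sphMeasure d) := by
  obtain ⟨c, hc, hcap⟩ := cap_lower d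
  set m := min ε 1 with hm
  have hm0 : 0 < m := lt_min hε one_pos
  have hm1 : m ≤ 1 := min_le_right _ _
  have hme : m ≤ ε := min_le_left _ _
  set E : ℝ := Real.exp ((d+1) * (2*d+3)) with hE
  have hE0 : 0 < E := Real.exp_pos _
  have hd0 : (0:ℝ) < d := by exact_mod_cast hd
  refine ⟨(d:ℝ)^d * N * (2*E)^p * 8^d / (c * m^d) + 1, by positivity, fun L hL Q hQ => ?_⟩
  have hL0 : (0:ℝ) < L := by exact_mod_cast hL
  have hL1 : (1:ℝ) ≤ L := by exact_mod_cast hL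
  obtain ⟨H1, H2, hH1, hH2, hQe⟩ := decomp d L hL Q hQ
  set q := ENNReal.ofReal p with hq
  have hq1 : 1 ≤ q := by rw [hq]; simpa using hp
  obtain ⟨hn1, hn2⟩ := decomp_norm d L hL q hq1 Q H1 H2 hH1 hH2 hQe
  have hQc : Continuous Q := by
    rw [funext hQe]; exact (ev_cont H1).add (ev_cont H2)
  set δ := m / (4 * (L+1)) with hδ
  have hδ0 : 0 < δ := by positivity
  have hδL : δ * L ≤ 1 := by
    rw [hδ, div_mul_eq_mul_div, div_le_one (by positivity)]
    nlinarith
  have hδL2 : m / 8 ≤ δ * L := by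
    rw [hδ, div_mul_eq_mul_div, div_le_div_iff₀ (by norm_num) (by positivity)]
    nlinarith
  have hδ1 : δ ≤ 1 := by nlinarith
  set F1 : Sph d → ℝ := fun x => Phi L δ H1 (fun i => (x : Esp d) i) with hF1
  set F2 : Sph d → ℝ := fun x => Phi L δ H2 (fun i => (x : Esp d) i) with hF2
  have hF1c : Continuous F1 := (Phi_cont L δ H1).comp coord_cont
  have hF2c : Continuous F2 := (Phi_cont L δ H2).comp coord_cont
  have hF0 : ∀ x, 0 ≤ F1 x + F2 x := fun x => add_nonneg (Phi_nonneg L δ hδ0.le H1 _) (Phi_nonneg L δ hδ0.le H2 _)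
  have hFc : Continuous (fun x => F1 x + F2 x) := hF1c.add hF2c
  have hmaj : ∀ z x : Sph d, x ∈ Metric.ball z δ → |Q z| ≤ F1 x + F2 x := by
    intro z x hx
    have hco : ∀ i, |(z : Esp d) i - (x : Esp d) i| ≤ δ := by
      intro i
      have := PiLp.norm_apply_le ((z : Esp d) - (x : Esp d)) i
      rw [Metric.mem_ball, Subtype.dist_eq, dist_comm, dist_eq_norm] at hx
      exact this.trans hx.le
    rw [hQe]
    refine (abs_add_le _ _).trans (add_le_add ?_ ?_)
    · exact le_Phi L δ hδ0.le H1 hH1.totalDegree_le _ _ hco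
    · exact le_Phi L δ hδ0.le H2 (hH2.totalDegree_le.trans (by omega)) _ _ hco
  have hnorm : eLpNorm (fun x => F1 x + F2 x) q (sphMeasure d) ≤ ENNReal.ofReal (2 * E) * eLpNorm Q q (sphMeasure d) := by
    refine (eLpNorm_add_le hF1c.aestronglyMeasurable hF2c.aestronglyMeasurable hq1).trans ?_
    have a1 := (eLp_Phi L hL q hq1 L le_rfl δ hδ0.le hδL H1 hH1).trans (mul_le_mul_right hn1 _)
    have a2 := (eLp_Phi L hL q hq1 (L-1) (by omega) δ hδ0.le hδL H2 hH2).trans (mul_le_mul_right hn2 _)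
    refine (add_le_add a1 a2).trans (le_of_eq ?_)
    rw [← two_mul, ← mul_assoc, ENNReal.ofReal_mul (by norm_num)]
    simp [hE]
  have hI := int_of_eLp p hp _ Q hFc hQc (2*E) (by positivity) hnorm
  set I := ∫ x, |Q x|^p ∂(sphMeasure d) with hIdef
  have hI0 : 0 ≤ I := integral_nonneg fun x => by positivity
  obtain ⟨color, hcol⟩ := hsep L
  have hGc : Continuous (fun x => |F1 x + F2 x|^p) :=
    hFc.abs.rpow_const fun x => Or.inr (by linarith)
  have hsum := sum_caps N (Z L) δ color (by
    intro z w hne hzw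
    have h1 := hcol z w hne hzw
    have h2 : m / (L+1) ≤ gdist d z.1 w.1 := le_trans (by gcongr) h1
    have h3 := chord_lower z.1 w.1 (m/(L+1)) (by positivity) (by rw [div_le_one (by positivity)]; linarith) h2
    have h4 : m / (L+1) / 2 = δ + δ := by rw [hδ]; field_simp; norm_num
    linarith) (fun x => |F1 x + F2 x|^p) hGc (fun x => by positivity)
  have hpt : ∀ z ∈ Z L, c * δ^d * |Q z|^p ≤ ∫ x in Metric.ball z δ, |F1 x + F2 x|^p ∂(sphMeasure d) := by
    intro z _
    have h1 : ∫ x in Metric.ball z δ, |Q z|^p ∂(sphMeasure d) ≤ ∫ x in Metric.ball z δ, |F1 x + F2 x|^p ∂(sphMeasure d) := by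
      apply setIntegral_mono_on (integrable_const _).integrableOn (cont_int _ hGc).integrableOn Metric.isOpen_ball.measurableSet
      intro x hx
      apply Real.rpow_le_rpow (abs_nonneg _) _ (by linarith)
      exact (hmaj z x hx).trans (le_abs_self _)
    rw [setIntegral_const, smul_eq_mul] at h1
    refine le_trans ?_ h1
    have := hcap z δ hδ0 hδ1
    gcongr
  have h1 : c * δ^d * ∑ z ∈ Z L, |Q z|^p ≤ N * ((2*E)^p * I) := by
    rw [Finset.mul_sum]
    refine (Finset.sum_le_sum hpt).trans (hsum.trans ?_)
    gcongr
  have hdim := dim_lower' d L hd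
  have hfr : 0 < (Module.finrank ℝ (PiSp d L) : ℝ) := lt_of_lt_of_le (by positivity) hdim
  have hS0 : 0 ≤ ∑ z ∈ Z L, |Q z|^p := Finset.sum_nonneg fun _ _ => by positivity
  rw [inv_mul_le_iff₀ hfr]
  have hpw : m^d / 8^d ≤ δ^d * L^d := by
    rw [← div_pow, ← mul_pow]; gcongr
  have hmain : ∑ z ∈ Z L, |Q z|^p ≤ ((L:ℝ)^d / d^d) * ((d:ℝ)^d * N * (2*E)^p * 8^d / (c * m^d) * I) := by
    have h2 : ((L:ℝ)^d / d^d) * ((d:ℝ)^d * N * (2*E)^p * 8^d / (c * m^d) * I) = (N * ((2*E)^p * I)) * L^d * 8^d / (c * m^d) := by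
      field_simp
    rw [h2, le_div_iff₀ (by positivity)]
    have h3 : m^d ≤ δ^d * L^d * 8^d := by rwa [div_le_iff₀ (by positivity)] at hpw
    calc (∑ z ∈ Z L, |Q z|^p) * (c * m^d) ≤ (∑ z ∈ Z L, |Q z|^p) * (c * (δ^d * L^d * 8^d)) := by gcongr
      _ = (c * δ^d * ∑ z ∈ Z L, |Q z|^p) * L^d * 8^d := by ring
      _ ≤ _ := by gcongr
  refine hmain.trans ?_
  gcongr
  linarith

end
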